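/- arXiv:math/0406448 — 5 statements merged into one kernel-verified Lean document; each statement's English description precedes it below -/
import Mathlib

section
/- Let X be a normed linear space over the real or complex numbers and let F : X → 𝕂 be a linear functional satisfying |F(x)| ≤ ‖x‖ for all x ∈ X. Suppose x_1, …, x_n ∈ X and k_1, …, k_n ≥ 0 satisfy ‖x_i‖ − Re F(x_i) ≤ k_i for each i. Then equality holds in ∑_{i=1}^n ‖x_i‖ − ‖∑_{i=1}^n x_i‖ ≤ ∑_{i=1}^n k_i if and only if both F(∑_{i=1}^n x_i) = ‖∑_{i=1}^n x_i‖ and F(∑_{i=1}^n x_i) = ∑_{i=1}^n ‖x_i‖ − ∑_{i=1}^n k_i. -/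
/-- Equality case in the additive reverse of the generalised triangle inequality
(Theorem `t5.1`): equality holds in `∑ ‖x i‖ - ‖∑ x i‖ ≤ ∑ k i` iff both
`F (∑ x i) = ‖∑ x i‖` and `F (∑ x i) = ∑ ‖x i‖ - ∑ k i`. -/
theorem additive_reverse_triangle_equality_iff
    {𝕂 : Type*} [RCLike 𝕂] {X : Type*} [NormedAddCommGroup X] [NormedSpace 𝕂 X]
    (F : X →ₗ[𝕂] 𝕂) (hF : ∀ x : X, ‖F x‖ ≤ ‖x‖)
    (n : ℕ) (x : Fin n → X) (k : Fin n → ℝ) (hk : ∀ i, 0 ≤ k i)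
    (h : ∀ i, ‖x i‖ - RCLike.re (F (x i)) ≤ k i) :
    ∑ i, ‖x i‖ - ‖∑ i, x i‖ = ∑ i, k i ↔
      (F (∑ i, x i) = ((‖∑ i, x i‖ : ℝ) : 𝕂) ∧
        F (∑ i, x i) = ((∑ i, ‖x i‖ - ∑ i, k i : ℝ) : 𝕂)) := by
  have hsum : ∑ i, ‖x i‖ - RCLike.re (F (∑ i, x i)) ≤ ∑ i, k i := by
    rw [map_sum, map_sum, ← Finset.sum_sub_distrib]
    exact Finset.sum_le_sum fun i _ => h i
  constructor
  · intro heq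
    have hle : ‖∑ i, x i‖ ≤ RCLike.re (F (∑ i, x i)) := by linarith
    have hre : RCLike.re (F (∑ i, x i)) = ‖∑ i, x i‖ :=
      le_antisymm ((RCLike.re_le_norm _).trans (hF _)) hle
    have hself := RCLike.re_eq_self_of_le ((hF _).trans hle)
    rw [hre] at hself
    refine ⟨hself.symm, hself.symm.trans ?_⟩
    rw [← heq, sub_sub_cancel]
  · rintro ⟨hnorm, hdiff⟩
    have := RCLike.ofReal_injective (hnorm.symm.trans hdiff)
    linarith
end

section
/- Let X be a normed linear space over 𝕂 = ℝ or ℂ with norm ‖·‖, and let [·,·] : X × X → 𝕂 be a semi-inner product generating the norm (i.e., [·,·] is additive and 𝕂-homogeneous in the first variable, conjugate-homogeneous in the second variable, satisfies |[x,y]|² ≤ [x,x][y,y] for all x, y, and [x,x] = ‖x‖² for all x). Let e ∈ X with ‖e‖ = 1. If x_1, …, x_n ∈ X and k_1, …, k_n ≥ 0 are such that ‖x_i‖ − Re [x_i, e] ≤ k_i for each i ∈ {1, …, n}, then 0 ≤ ∑_{i=1}^n ‖x_i‖ − ‖∑_{i=1}^n x_i‖ ≤ ∑_{i=1}^n k_i.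 -/
/-- Additive reverse of the generalised triangle inequality via a semi-inner product
(Corollary `c5.1`, first part). Here `sip` is a semi-inner product generating the
norm of `X` and `e` is a unit vector. -/
theorem additive_reverse_triangle_semiInner
    {𝕂 : Type*} [RCLike 𝕂] {X : Type*} [NormedAddCommGroup X] [NormedSpace 𝕂 X]
    (sip : X → X → 𝕂)
    (sip_add : ∀ x y z : X, sip (x + y) z = sip x z + sip y z)
    (sip_smul_left : ∀ (l : 𝕂) (x y : X), sip (l • x) y = l * sip x y)
    (sip_smul_right : ∀ (l : 𝕂) (x y : X), sip x (l • y) = (starRingEnd 𝕂) l * sip x y)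
    (sip_schwarz : ∀ x y : X, ‖sip x y‖ ^ 2 ≤ ‖x‖ ^ 2 * ‖y‖ ^ 2)
    (sip_norm : ∀ x : X, sip x x = ((‖x‖ ^ 2 : ℝ) : 𝕂))
    (e : X) (he : ‖e‖ = 1)
    (n : ℕ) (x : Fin n → X) (k : Fin n → ℝ) (hk : ∀ i, 0 ≤ k i)
    (h : ∀ i, ‖x i‖ - RCLike.re (sip (x i) e) ≤ k i) :
    0 ≤ ∑ i, ‖x i‖ - ‖∑ i, x i‖ ∧ ∑ i, ‖x i‖ - ‖∑ i, x i‖ ≤ ∑ i, k i := by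
  refine ⟨sub_nonneg.mpr (norm_sum_le _ _), ?_⟩
  have re_sip_sum : RCLike.re (sip (∑ i, x i) e) = ∑ i, RCLike.re (sip (x i) e) :=
    map_sum (AddMonoidHom.mk' (fun y => RCLike.re (sip y e))
      fun y z => by rw [sip_add, map_add]) x Finset.univ
  have re_sip_le : RCLike.re (sip (∑ i, x i) e) ≤ ‖∑ i, x i‖ :=
    (RCLike.re_le_norm _).trans <|
      le_of_pow_le_pow_left₀ two_ne_zero (norm_nonneg _)
        (by simpa only [he, one_pow, mul_one] using sip_schwarz (∑ i, x i) e)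
  have sum_le := Finset.sum_le_sum fun i (_ : i ∈ Finset.univ) => h i
  rw [Finset.sum_sub_distrib] at sum_le
  linarith
end

section
/- Let X be a normed linear space over 𝕂 = ℝ or ℂ with norm ‖·‖, and let [·,·] : X × X → 𝕂 be a semi-inner product generating the norm (i.e., [·,·] is additive and 𝕂-homogeneous in the first variable, conjugate-homogeneous in the second variable, satisfies |[x,y]|² ≤ [x,x][y,y] for all x, y, and [x,x] = ‖x‖² for all x). Let e ∈ X with ‖e‖ = 1. If x_1, …, x_n ∈ X and r ≥ 0 are such that r‖x_i‖ ≤ Re [x_i, e] for each i ∈ {1, …, n}, then r ∑_{i=1}^n ‖x_i‖ ≤ ‖∑_{i=1}^n x_i‖. -/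
/-- Diaz–Metcalf type inequality via a semi-inner product (Corollary `c3.1`).
If `r ‖x i‖ ≤ Re [x i, e]` for a unit vector `e`, then
`r ∑ ‖x i‖ ≤ ‖∑ x i‖`. -/
theorem diaz_metcalf_semiInner
    {𝕂 : Type*} [RCLike 𝕂] {X : Type*} [NormedAddCommGroup X] [NormedSpace 𝕂 X]
    (sip : X → X → 𝕂)
    (sip_add : ∀ x y z : X, sip (x + y) z = sip x z + sip y z)
    (sip_smul_left : ∀ (l : 𝕂) (x y : X), sip (l • x) y = l * sip x y)
    (sip_smul_right : ∀ (l : 𝕂) (x y : X), sip x (l • y) = (starRingEnd 𝕂) l * sip x y)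
    (sip_schwarz : ∀ x y : X, ‖sip x y‖ ^ 2 ≤ ‖x‖ ^ 2 * ‖y‖ ^ 2)
    (sip_norm : ∀ x : X, sip x x = ((‖x‖ ^ 2 : ℝ) : 𝕂))
    (e : X) (he : ‖e‖ = 1)
    (n : ℕ) (x : Fin n → X) (r : ℝ) (hr : 0 ≤ r)
    (h : ∀ i, r * ‖x i‖ ≤ RCLike.re (sip (x i) e)) :
    r * ∑ i, ‖x i‖ ≤ ‖∑ i, x i‖ := by
  have sip_sum : sip (∑ i, x i) e = ∑ i, sip (x i) e :=
    map_sum (AddMonoidHom.mk' (fun y => sip y e) fun y z => sip_add y z e) x Finset.univ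
  have sip_le : ‖sip (∑ i, x i) e‖ ≤ ‖∑ i, x i‖ := by
    have hs := sip_schwarz (∑ i, x i) e
    rw [he, one_pow, mul_one] at hs
    exact (sq_le_sq₀ (norm_nonneg _) (norm_nonneg _)).mp hs
  calc r * ∑ i, ‖x i‖ = ∑ i, r * ‖x i‖ := Finset.mul_sum _ _ _
    _ ≤ ∑ i, RCLike.re (sip (x i) e) := Finset.sum_le_sum fun i _ => h i
    _ = RCLike.re (sip (∑ i, x i) e) := by rw [sip_sum, map_sum]
    _ ≤ ‖sip (∑ i, x i) e‖ := RCLike.re_le_norm _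
    _ ≤ ‖∑ i, x i‖ := sip_le
end

section
/- Let X be a strictly convex normed linear space over 𝕂 = ℝ or ℂ, and let [·,·] : X × X → 𝕂 be a semi-inner product generating the norm (i.e., [·,·] is additive and 𝕂-homogeneous in the first variable, conjugate-homogeneous in the second variable, satisfies |[x,y]|² ≤ [x,x][y,y] for all x, y, and [x,x] = ‖x‖² for all x). Let e ∈ X with ‖e‖ = 1, let r ≥ 0, and let x_1, …, x_n ∈ X satisfy r‖x_i‖ ≤ Re [x_i, e] for each i ∈ {1, …, n}. Then the equality r ∑_{i=1}^n ‖x_i‖ = ‖∑_{i=1}^n x_i‖ holds if and only if ∑_{i=1}^n x_i = r (∑_{i=1}^n ‖x_i‖) e. -/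
/-- In a strictly convex space, a unit vector `y` at which a norm-bounded additive functional `f`
attains the value `1`, as it does at the unit vector `e`, equals `e`. -/
theorem eq_of_one_le_re_of_strictlyConvex
    {𝕂 : Type*} [RCLike 𝕂] {X : Type*} [NormedAddCommGroup X] [NormedSpace 𝕂 X]
    (hsc : ∀ x y : X, x ≠ y → ‖x‖ = 1 → ‖y‖ = 1 →
      ∀ l : ℝ, 0 < l → l < 1 → ‖((l : 𝕂) • x + ((1 - l : ℝ) : 𝕂) • y)‖ < 1)
    (f : X →ₗ[𝕂] 𝕂) (hf : ∀ z, RCLike.re (f z) ≤ ‖z‖) {y e : X} (hy : ‖y‖ = 1) (he : ‖e‖ = 1)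
    (hfy : 1 ≤ RCLike.re (f y)) (hfe : 1 ≤ RCLike.re (f e)) : y = e := by
  by_contra hne
  have hlt := hsc y e hne hy he (1 / 2) (by norm_num) (by norm_num)
  have hle := hf (((1 / 2 : ℝ) : 𝕂) • y + ((1 - 1 / 2 : ℝ) : 𝕂) • e)
  rw [map_add, map_smul, map_smul, smul_eq_mul, smul_eq_mul, map_add, RCLike.re_ofReal_mul,
    RCLike.re_ofReal_mul] at hle
  linarith

/-- In a strictly convex space, if a norm-bounded functional `f` attains its norm `1` at the unit
vector `e`, then any `s` with `‖s‖ ≤ Re (f s)` is a nonnegative multiple of `e`. -/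
theorem eq_norm_smul_of_norm_le_re_of_strictlyConvex
    {𝕂 : Type*} [RCLike 𝕂] {X : Type*} [NormedAddCommGroup X] [NormedSpace 𝕂 X]
    (hsc : ∀ x y : X, x ≠ y → ‖x‖ = 1 → ‖y‖ = 1 →
      ∀ l : ℝ, 0 < l → l < 1 → ‖((l : 𝕂) • x + ((1 - l : ℝ) : 𝕂) • y)‖ < 1)
    (f : X →ₗ[𝕂] 𝕂) (hf : ∀ z, RCLike.re (f z) ≤ ‖z‖) {s e : X} (he : ‖e‖ = 1)
    (hfe : 1 ≤ RCLike.re (f e)) (hs : ‖s‖ ≤ RCLike.re (f s)) : s = ((‖s‖ : ℝ) : 𝕂) • e := by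
  rcases eq_or_ne s 0 with rfl | hs0
  · simp
  have hpos : 0 < ‖s‖ := norm_pos_iff.mpr hs0
  have hy : ((‖s‖⁻¹ : ℝ) : 𝕂) • s = e := by
    refine eq_of_one_le_re_of_strictlyConvex hsc f hf ?_ he ?_ hfe
    · rw [norm_smul, RCLike.norm_ofReal, abs_of_pos (inv_pos.mpr hpos), inv_mul_cancel₀ hpos.ne']
    · rw [map_smul, smul_eq_mul, RCLike.re_ofReal_mul, ← inv_mul_cancel₀ hpos.ne']
      gcongr
  rw [← hy, smul_smul, ← RCLike.ofReal_mul, mul_inv_cancel₀ hpos.ne', RCLike.ofReal_one, one_smul]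


/-- Equality case of the Diaz–Metcalf inequality in a strictly convex normed space
(Corollary `c3.2`): under `r ‖x i‖ ≤ Re [x i, e]`, one has
`r ∑ ‖x i‖ = ‖∑ x i‖` iff `∑ x i = r (∑ ‖x i‖) e`. -/
theorem diaz_metcalf_semiInner_equality_iff
    {𝕂 : Type*} [RCLike 𝕂] {X : Type*} [NormedAddCommGroup X] [NormedSpace 𝕂 X]
    (hsc : ∀ x y : X, x ≠ y → ‖x‖ = 1 → ‖y‖ = 1 →
      ∀ l : ℝ, 0 < l → l < 1 → ‖((l : 𝕂) • x + ((1 - l : ℝ) : 𝕂) • y)‖ < 1)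
    (sip : X → X → 𝕂)
    (sip_add : ∀ x y z : X, sip (x + y) z = sip x z + sip y z)
    (sip_smul_left : ∀ (l : 𝕂) (x y : X), sip (l • x) y = l * sip x y)
    (sip_smul_right : ∀ (l : 𝕂) (x y : X), sip x (l • y) = (starRingEnd 𝕂) l * sip x y)
    (sip_schwarz : ∀ x y : X, ‖sip x y‖ ^ 2 ≤ ‖x‖ ^ 2 * ‖y‖ ^ 2)
    (sip_norm : ∀ x : X, sip x x = ((‖x‖ ^ 2 : ℝ) : 𝕂))
    (e : X) (he : ‖e‖ = 1)
    (n : ℕ) (x : Fin n → X) (r : ℝ) (hr : 0 ≤ r)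
    (h : ∀ i, r * ‖x i‖ ≤ RCLike.re (sip (x i) e)) :
    r * ∑ i, ‖x i‖ = ‖∑ i, x i‖ ↔
      ∑ i, x i = ((r * ∑ i, ‖x i‖ : ℝ) : 𝕂) • e := by
  constructor
  · intro heq
    let f : X →ₗ[𝕂] 𝕂 :=
      { toFun := fun z => sip z e
        map_add' := fun a b => sip_add a b e
        map_smul' := fun l a => sip_smul_left l a e }
    have hf : ∀ z, RCLike.re (f z) ≤ ‖z‖ := fun z => by
      have hz := sip_schwarz z e
      rw [he, one_pow, mul_one] at hz
      exact (RCLike.re_le_norm _).trans ((sq_le_sq₀ (norm_nonneg _) (norm_nonneg _)).mp hz)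
    have hfe : 1 ≤ RCLike.re (f e) := by
      change 1 ≤ RCLike.re (sip e e)
      rw [sip_norm, he, RCLike.ofReal_re, one_pow]
    rw [heq]
    refine eq_norm_smul_of_norm_le_re_of_strictlyConvex hsc f hf he hfe ?_
    rw [← heq, Finset.mul_sum, map_sum, map_sum]
    exact Finset.sum_le_sum fun i _ => h i
  · intro heq
    have hnonneg : 0 ≤ r * ∑ i, ‖x i‖ :=
      mul_nonneg hr (Finset.sum_nonneg fun i _ => norm_nonneg (x i))
    rw [heq, norm_smul, he, mul_one, RCLike.norm_ofReal, abs_of_nonneg hnonneg]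
end

section
/- Let X be a normed linear space over 𝕂 = ℝ or ℂ and let F_1, …, F_m be bounded linear functionals on X. If x_1, …, x_n ∈ X and M_{ik} ≥ 0 for i ∈ {1, …, n}, k ∈ {1, …, m} satisfy ‖x_i‖ − Re F_k(x_i) ≤ M_{ik} for each i and k, then ∑_{i=1}^n ‖x_i‖ ≤ ‖(1/m) ∑_{k=1}^m F_k‖ · ‖∑_{i=1}^n x_i‖ + (1/m) ∑_{k=1}^m ∑_{i=1}^n M_{ik}. -/
/-- Reverse of the generalised triangle inequality for `m` bounded linear functionals
(Theorem `t2.1`): if `‖x i‖ - Re (F k (x i)) ≤ M i k`, then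
`∑ ‖x i‖ ≤ ‖(1/m) ∑ F k‖ ‖∑ x i‖ + (1/m) ∑ₖ ∑ᵢ M i k`. -/
theorem reverse_triangle_m_functionals
    {𝕂 : Type*} [RCLike 𝕂] {X : Type*} [NormedAddCommGroup X] [NormedSpace 𝕂 X]
    (m n : ℕ) (hm : 0 < m) (F : Fin m → X →L[𝕂] 𝕂) (x : Fin n → X)
    (M : Fin n → Fin m → ℝ) (hM : ∀ i k, 0 ≤ M i k)
    (h : ∀ i k, ‖x i‖ - RCLike.re (F k (x i)) ≤ M i k) :
    ∑ i, ‖x i‖ ≤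
      ‖(m : 𝕂)⁻¹ • ∑ k, F k‖ * ‖∑ i, x i‖ + (m : ℝ)⁻¹ * ∑ k, ∑ i, M i k := by
  have hm' : (0 : ℝ) < m := Nat.cast_pos.mpr hm
  have re_average : RCLike.re (((m : 𝕂)⁻¹ • ∑ k, F k) (∑ i, x i)) =
      (m : ℝ)⁻¹ * ∑ k, ∑ i, RCLike.re (F k (x i)) := by
    have hcast : (m : 𝕂)⁻¹ = (((m : ℝ)⁻¹ : ℝ) : 𝕂) := by push_cast; rfl
    rw [smul_apply, hcast, smul_eq_mul, RCLike.re_ofReal_mul,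
      sum_apply]
    simp only [map_sum]
  have re_le : RCLike.re (((m : 𝕂)⁻¹ • ∑ k, F k) (∑ i, x i)) ≤
      ‖(m : 𝕂)⁻¹ • ∑ k, F k‖ * ‖∑ i, x i‖ :=
    (RCLike.re_le_norm _).trans (ContinuousLinearMap.le_opNorm _ _)
  have sum_le : (m : ℝ) * ∑ i, ‖x i‖ ≤
      ∑ k, ∑ i, RCLike.re (F k (x i)) + ∑ k, ∑ i, M i k := by
    calc (m : ℝ) * ∑ i, ‖x i‖ = ∑ _k : Fin m, ∑ i, ‖x i‖ := by simp
      _ ≤ ∑ k, ∑ i, (RCLike.re (F k (x i)) + M i k) :=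
        Finset.sum_le_sum fun k _ => Finset.sum_le_sum fun i _ => by linarith [h i k]
      _ = _ := by simp only [Finset.sum_add_distrib]
  calc ∑ i, ‖x i‖ ≤ (m : ℝ)⁻¹ * (∑ k, ∑ i, RCLike.re (F k (x i)) + ∑ k, ∑ i, M i k) :=
        (le_inv_mul_iff₀ hm').mpr sum_le
    _ ≤ _ := by rw [mul_add, ← re_average]; gcongr
end
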